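/- For nonnegative integer s and complex variables z_1,…,z_{m+n}: ∑_λ a_s(λ) s_λ(z)/s_λ(1^{m+n}) = ∑_{μ,ν} b_s(μ,ν) s_μ(z_1,…,z_m) s_ν(z_{m+1},…,z_{m+n}) / (s_μ(1^m) s_ν(1^n)), where a_s(λ) = 1/(h(λ) h(λ + (s^{m+n}))) and b_s(μ,ν) = ∏_{i,j} ((m+n−i−j+1)/(μ_i+ν_j+m+n−i−j+s+1)) / (h(μ)h(ν)h(μ+(s^m))h(ν+(s^n))), summing over partitions λ of length ≤ m+n, μ of length ≤ m, ν of length ≤ n. -/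

import Mathlib

open Finset Matrix

/-- The product of the hook lengths of a partition with at most `n` parts,
given by the (weakly decreasing) row-length function `l`. -/
def hookProd (n : ℕ) (l : ℕ → ℕ) : ℕ :=
  ∏ i ∈ Finset.range n, ∏ j ∈ Finset.range (l i),
    (l i - j + ((Finset.Ico (i + 1) n).filter (fun i' => j < l i')).card)

/-- Partitions of length at most `N`, as weakly decreasing functions `ℕ → ℕ`
vanishing from index `N` on. -/
def PartLE (N : ℕ) : Type := {l : ℕ → ℕ // Antitone l ∧ ∀ i, N ≤ i → l i = 0}

/-- The normalized Schur polynomial `s_λ(z)/s_λ(1^N)`, with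
`s_λ(z) = det(zᵢ^{kⱼ})/Δ(z)` for `kⱼ = λⱼ + N - j` and
`s_λ(1^N) = Δ(k)/C_N` its principal specialization. -/
noncomputable def schurNorm {N : ℕ} (z : Fin N → ℂ) (l : ℕ → ℕ) : ℂ :=
  (Matrix.det (Matrix.of fun i j : Fin N => z i ^ (l j + (N - 1 - (j : ℕ)))) /
      ∏ i : Fin N, ∏ j ∈ Finset.Ioi i, (z i - z j)) /
    ((∏ i : Fin N, ∏ j ∈ Finset.Ioi i,
        (((l i + (N - 1 - (i : ℕ))) : ℂ) - ((l j + (N - 1 - (j : ℕ))) : ℂ))) /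
      ∏ i ∈ Finset.range N, (i.factorial : ℂ))

def mixM {P : Type} (F : P → P → ℂ) (q : ℕ → P → ℂ) (m n : ℕ) (x : Fin m → P) (y : ℕ → P) :
    Matrix (Fin m) (Fin m) ℂ :=
  Matrix.of fun i j => if (j : ℕ) < n then F (x i) (y j) else q (j - n) (x i)

theorem mix_step {P : Type} (F : P → P → ℂ) (q : ℕ → P → ℂ) (X : P → ℂ)
    (hF : ∀ u v, F u v * (X u - X v) = q 1 u * q 0 v - q 0 u * q 1 v)
    (hq : ∀ a u, q (a + 2) u = X u * q a u)
    (m n : ℕ) (hmn : n + 1 ≤ m) (x : Fin m → P) (y : ℕ → P) :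
    (∏ j : Fin n, (X (y j) - X (y n))) * (mixM F q (m + 1) n (Fin.cons (y n) x) y).det =
      (-1) ^ n * ((∏ i : Fin m, (X (x i) - X (y n))) * (mixM F q m (n + 1) x y).det) := by
  set t := y n with ht
  set x' : Fin (m + 1) → P := Fin.cons t x with hx'
  let jn : Fin (m + 1) := ⟨n, by omega⟩
  let jn1 : Fin (m + 1) := ⟨n + 1, by omega⟩
  set A := mixM F q (m + 1) n x' y with hA
  let C1 : Matrix (Fin (m + 1)) (Fin (m + 1)) ℂ := Matrix.of fun j' j =>
    (if j' = j then (if (j : ℕ) < n then X (y j) - X t else 1) else 0)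
    + (if j' = jn1 then (if (j : ℕ) < n then q 0 (y j) else 0) else 0)
    - (if j' = jn then (if (j : ℕ) < n then q 1 (y j) else 0) else 0)
  let C2 : Matrix (Fin (m + 1)) (Fin (m + 1)) ℂ := Matrix.of fun j' j =>
    (if j' = j then 1 else 0)
    - (if j' = (⟨(j : ℕ) - 2, by omega⟩ : Fin (m + 1)) then
        (if n + 2 ≤ (j : ℕ) then X t else 0) else 0)
  let B : Matrix (Fin (m + 1)) (Fin (m + 1)) ℂ := Matrix.of fun i j =>
    if (j : ℕ) < n then (X (x' i) - X t) * F (x' i) (y j)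
    else if (j : ℕ) = n then q 0 (x' i) else if (j : ℕ) = n + 1 then q 1 (x' i)
    else (X (x' i) - X t) * q (j - n - 2) (x' i)
  have hC1 : C1.det = ∏ j : Fin n, (X (y j) - X t) := by
    rw [Matrix.det_of_isLowerTriangular]
    · have h1 : ∀ j : Fin (m + 1), C1 j j = if (j : ℕ) < n then X (y j) - X t else 1 := by
        intro j
        simp only [C1, Matrix.of_apply, if_true, jn, jn1, Fin.ext_iff]
        split_ifs <;> first | omega | simp
      simp only [h1]
      rw [Fin.prod_univ_eq_prod_range (fun j => if j < n then X (y j) - X t else 1) (m + 1),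
        Fin.prod_univ_eq_prod_range (fun j => X (y j) - X t) n]
      rw [← Finset.prod_filter]
      congr 1
      ext j; simp; omega
    · intro i j hij
      have hij' : (i : ℕ) < j := hij
      simp only [C1, Matrix.of_apply, jn, jn1, Fin.ext_iff]
      split_ifs <;> first | omega | simp
  have hC2 : C2.det = 1 := by
    rw [Matrix.det_of_isUpperTriangular]
    · apply Finset.prod_eq_one
      intro j _
      simp only [C2, Matrix.of_apply, if_true, Fin.ext_iff]
      split_ifs <;> first | omega | simp
    · intro i j hij
      have hij' : (j : ℕ) < i := hij
      simp only [C2, Matrix.of_apply, Fin.ext_iff]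
      split_ifs <;> first | omega | simp
  have hprod : A * C1 * C2 = B := by
    have hAC : ∀ i j, (A * C1) i j = if (j : ℕ) < n then (X (x' i) - X t) * F (x' i) (y j) else
        q (j - n) (x' i) := by
      intro i j
      simp only [Matrix.mul_apply, C1, Matrix.of_apply, mul_add, mul_sub, mul_ite, mul_zero,
        mul_one, Finset.sum_add_distrib, Finset.sum_sub_distrib, Finset.sum_ite_eq',
        Finset.mem_univ, if_true]
      by_cases h : (j : ℕ) < n
      · have e1 : n + 1 - n = 1 := by omega
        simp only [hA, mixM, Matrix.of_apply, jn, jn1, h, if_true, lt_irrefl, if_false, e1,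
          Nat.sub_self, show ¬ (n + 1 < n) by omega]
        linear_combination -hF (x' i) (y j)
      · simp [hA, mixM, h]
    ext i j
    rw [Matrix.mul_apply]
    simp only [hAC, C2, Matrix.of_apply, mul_sub, mul_ite, mul_zero,
        mul_one, Finset.sum_sub_distrib, Finset.sum_ite_eq',
        Finset.mem_univ, if_true, B]
    by_cases h : (j : ℕ) < n
    · simp [h, show ¬ (n + 2 ≤ (j : ℕ)) by omega]
    by_cases h1 : (j : ℕ) = n
    · simp [h1]
    by_cases h2 : (j : ℕ) = n + 1
    · simp [h2]
    · have e1 : (j : ℕ) - 2 - n = j - n - 2 := by omega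
      have e2 : (j : ℕ) - n = (j - n - 2) + 2 := by omega
      have e3 := hq (j - n - 2) (x' i)
      rw [← e2] at e3
      simp only [h, h1, h2, if_false, show ¬ ((j : ℕ) - 2 < n) by omega,
        show n + 2 ≤ (j : ℕ) by omega, if_true, e1, e3]
      ring
  have hdet : (∏ j : Fin n, (X (y j) - X t)) * A.det = B.det := by
    rw [← hprod, Matrix.det_mul, Matrix.det_mul, hC1, hC2]; ring
  rw [hdet]
  let N : Matrix (Fin m) (Fin m) ℂ := Matrix.of fun i j =>
    (X (x i) - X t) * mixM F q m (n + 1) x y i j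
  have hN : N.det = (∏ i : Fin m, (X (x i) - X t)) * (mixM F q m (n + 1) x y).det :=
    Matrix.det_mul_column _ _
  rw [← hN]
  let c : Fin m := ⟨n, by omega⟩
  have hm1 : B.submatrix Fin.succ jn.succAbove = N.updateCol c (fun i => q 1 (x i)) := by
    ext i j
    simp only [Matrix.submatrix_apply, Matrix.updateCol_apply, N, B, Matrix.of_apply, mixM,
      hx', Fin.cons_succ, Fin.succAbove, Fin.lt_def, jn, c, Fin.ext_iff]
    by_cases h : (j : ℕ) < n
    · simp [h, show (j : ℕ) ≠ n by omega, show (j : ℕ) < n + 1 by omega]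
    by_cases h1 : (j : ℕ) = n
    · simp [h1]
    · have : (j : ℕ) + 1 - n - 2 = j - (n + 1) := by omega
      simp [h, h1, show ¬ (j : ℕ) < n + 1 by omega, show ¬ (j : ℕ) + 1 < n by omega,
        show ¬ (j : ℕ) + 1 = n by omega, this]
  have hm0 : B.submatrix Fin.succ jn1.succAbove = N.updateCol c (fun i => q 0 (x i)) := by
    ext i j
    simp only [Matrix.submatrix_apply, Matrix.updateCol_apply, N, B, Matrix.of_apply, mixM,
      hx', Fin.cons_succ, Fin.succAbove, Fin.lt_def, jn1, c, Fin.ext_iff]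
    by_cases h : (j : ℕ) < n
    · simp [h, show (j : ℕ) ≠ n by omega, show (j : ℕ) < n + 1 by omega]
    by_cases h1 : (j : ℕ) = n
    · simp [h1]
    · have : (j : ℕ) + 1 - n - 2 = j - (n + 1) := by omega
      simp [h, h1, show ¬ (j : ℕ) < n + 1 by omega, show ¬ (j : ℕ) + 1 < n by omega,
        show ¬ (j : ℕ) + 1 = n by omega, this]
  have hNN : N.det = q 0 t * (N.updateCol c (fun i => q 1 (x i))).det
      - q 1 t * (N.updateCol c (fun i => q 0 (x i))).det := by
    have h0 : N = N.updateCol c ((q 0 t) • (fun i => q 1 (x i)) + (- q 1 t) • (fun i => q 0 (x i))) := by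
      ext i j
      rw [Matrix.updateCol_apply]
      split_ifs with h
      · subst h
        simp [N, mixM, c]
        rw [← ht]
        linear_combination hF (x i) t
      · rfl
    conv_lhs => rw [h0]
    rw [Matrix.det_updateCol_add, Matrix.det_updateCol_smul, Matrix.det_updateCol_smul]
    ring
  rw [hNN, Matrix.det_succ_row_zero]
  have hB0 : ∀ j, B 0 j = (if j = jn then q 0 t else 0) + (if j = jn1 then q 1 t else 0) := by
    intro j
    simp only [B, Matrix.of_apply, hx', Fin.cons_zero, sub_self, zero_mul, jn, jn1, Fin.ext_iff]
    split_ifs <;> first | omega | simp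
  simp only [hB0, mul_add, add_mul, mul_ite, ite_mul, mul_zero, zero_mul, Finset.sum_add_distrib,
    Finset.sum_ite_eq', Finset.mem_univ, if_true, hm1, hm0, Finset.sum_ite_eq]
  simp only [jn, jn1]
  ring

theorem mix_all (n : ℕ) : ∀ m N : ℕ, n ≤ m → N = m + n →
    ∃ ε : ℂ, ε ≠ 0 ∧ ∃ e : Fin N ≃ Fin m ⊕ Fin n,
    ∀ (P : Type) (F : P → P → ℂ) (q : ℕ → P → ℂ) (X : P → ℂ)
    (_ : ∀ u v, F u v * (X u - X v) = q 1 u * q 0 v - q 0 u * q 1 v)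
    (_ : ∀ a u, q (a + 2) u = X u * q a u) (x : Fin m → P) (y : ℕ → P),
    (∏ i : Fin m, ∏ j : Fin n, (X (x i) - X (y j))) * (mixM F q m n x y).det =
      ε * (Matrix.of fun r a : Fin N => q a (Sum.elim x (fun j : Fin n => y j) (e r))).det := by
  induction n with
  | zero =>
    intro m N _ hN
    subst hN
    refine ⟨1, one_ne_zero, (Equiv.sumEmpty (Fin _) (Fin 0)).symm, ?_⟩
    intro P F q X _ _ x y
    simp [mixM]
  | succ n ih =>
    intro m N hm hN
    obtain ⟨ε, hε, e, h⟩ := ih (m + 1) N (by omega) (by omega)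
    -- moves the head to the end
    let e1 : Fin (m + 1) ⊕ Fin n ≃ Fin m ⊕ Fin (n + 1) :=
      { toFun := Sum.elim (Fin.cons (Sum.inr (Fin.last n)) Sum.inl) (fun j => Sum.inr j.castSucc)
        invFun := Sum.elim (fun i => Sum.inl i.succ) (Fin.snoc (fun j => Sum.inr j) (Sum.inl 0))
        left_inv := by
          rintro (i | j)
          · refine Fin.cases ?_ (fun i => ?_) i <;> simp
          · simp
        right_inv := by
          rintro (i | j)
          · simp
          · refine Fin.lastCases ?_ (fun i => ?_) j <;> simp }
    refine ⟨(-1) ^ (n + n) * ε, by simp [hε], e.trans e1, ?_⟩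
    intro P F q X hF hq x y
    have hs := mix_step F q X hF hq m n (by omega) x y
    have h2 := h P F q X hF hq (Fin.cons (y n) x) y
    have hpt : ∀ r, Sum.elim x (fun j : Fin (n + 1) => y j) (e1 r) =
        Sum.elim (Fin.cons (y n) x : Fin (m + 1) → P) (fun j : Fin n => y j) r := by
      rintro (i | j)
      · refine Fin.cases ?_ (fun i => ?_) i <;> simp [e1]
      · simp [e1]
    simp only [Equiv.trans_apply, hpt]
    rw [mul_assoc, ← h2]
    rw [Fin.prod_univ_succ]
    simp only [Fin.prod_univ_castSucc, Fin.cons_zero, Fin.cons_succ, Fin.val_castSucc,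
      Fin.val_last, Finset.prod_mul_distrib]
    have h3 : (∏ j : Fin n, (X (y n) - X (y j))) = (-1) ^ n * ∏ j : Fin n, (X (y j) - X (y n)) := by
      have : (-1 : ℂ) ^ n = ∏ j : Fin n, (-1) := by simp
      rw [this, ← Finset.prod_mul_distrib]
      exact Finset.prod_congr rfl fun j _ => by ring
    rw [h3]
    have h4 : ((-1 : ℂ) ^ n) * (-1) ^ n = 1 := by rw [← mul_pow]; simp
    rw [pow_add]
    linear_combination (-((-1 : ℂ) ^ n * (-1) ^ n * (-1) ^ n) * (∏ i : Fin m, ∏ j : Fin n, (X (x i) - X (y j)))) * hs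
      - ((∏ i : Fin m, ∏ j : Fin n, (X (x i) - X (y j))) * (∏ i : Fin m, (X (x i) - X (y n))) * (mixM F q m (n + 1) x y).det) * (1 + (-1) ^ n * (-1) ^ n) * h4

theorem mix_append (m n : ℕ) (hmn : n ≤ m) :
    ∃ ε : ℂ, ε ≠ 0 ∧ ∀ (P : Type) (F : P → P → ℂ) (q : ℕ → P → ℂ) (X : P → ℂ)
    (_ : ∀ u v, F u v * (X u - X v) = q 1 u * q 0 v - q 0 u * q 1 v)
    (_ : ∀ a u, q (a + 2) u = X u * q a u) (x : Fin m → P) (y : ℕ → P),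
    (∏ i : Fin m, ∏ j : Fin n, (X (x i) - X (y j))) * (mixM F q m n x y).det =
      ε * (Matrix.of fun r a : Fin (m + n) =>
        q a (Fin.append x (fun j : Fin n => y j) r)).det := by
  obtain ⟨ε, hε, e, h⟩ := mix_all n m (m + n) hmn rfl
  let σ : Equiv.Perm (Fin (m + n)) := e.trans finSumFinEquiv
  refine ⟨ε * (Equiv.Perm.sign σ : ℤ), mul_ne_zero hε (by
    rcases Int.units_eq_one_or (Equiv.Perm.sign σ) with h | h <;> simp [h]), ?_⟩
  intro P F q X hF hq x y
  rw [h P F q X hF hq x y, mul_assoc, ← Matrix.det_permute]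
  congr 2
  ext r a
  simp only [Matrix.submatrix_apply, Matrix.of_apply, σ, id, Equiv.trans_apply]
  congr 1
  rcases e r with i | j <;> simp

theorem telescope_prod (c b : ℕ) (hb : b ≤ c) :
    (∏ j ∈ Finset.range b, (c + 1 - j)) * (c + 1 - b) =
      (c + 1) * ∏ j ∈ Finset.range b, (c - j) := by
  induction b with
  | zero => simp
  | succ b ih =>
    rw [Finset.prod_range_succ, Finset.prod_range_succ, ← mul_assoc, ← ih (by omega)]
    have : c + 1 - (b + 1) = c - b := by omega
    rw [this]

theorem hook_row (a : ℕ) (l : ℕ → ℕ) (r : ℕ) (h1 : ∀ t, t < r → l t ≤ a)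
    (h2 : ∀ t u, t ≤ u → u < r → l u ≤ l t) :
    (∏ j ∈ Finset.range a, (a - j + ((Finset.range r).filter (fun t => j < l t)).card)) *
      ∏ t ∈ Finset.range r, (a - l t + t + 1) = (a + r).factorial := by
  induction r with
  | zero =>
    simp only [Finset.range_zero, Finset.filter_empty, Finset.card_empty, add_zero,
      Finset.prod_empty, mul_one]
    rw [← Finset.prod_range_add_one_eq_factorial, ← Finset.prod_range_reflect]
    refine Finset.prod_congr rfl fun j hj => ?_
    have := Finset.mem_range.1 hj
    omega
  | succ r ih =>
    have ih := ih (fun t ht => h1 t (by omega)) (fun t u htu hu => h2 t u htu (by omega))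
    have hb : l r ≤ a := h1 r (by omega)
    have hc : ∀ (R j : ℕ), R ≤ r + 1 → j < l r →
        ((Finset.range R).filter (fun t => j < l t)).card = R := by
      intro R j hR hj
      rw [Finset.filter_true_of_mem, Finset.card_range]
      intro t ht
      have := Finset.mem_range.1 ht
      exact lt_of_lt_of_le hj (h2 t r (by omega) (by omega))
    have hd : ∀ j, ¬ j < l r → ((Finset.range (r + 1)).filter (fun t => j < l t)).card =
        ((Finset.range r).filter (fun t => j < l t)).card := by
      intro j hj
      rw [Finset.range_add_one, Finset.filter_insert, if_neg hj]
    have split : ∀ g : ℕ → ℕ, ∏ j ∈ Finset.range a, g j =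
        (∏ j ∈ Finset.range (l r), g j) * ∏ j ∈ Finset.Ico (l r) a, g j := by
      intro g
      exact (Finset.prod_range_mul_prod_Ico g hb).symm
    rw [split] at ih ⊢
    have e1 : ∏ j ∈ Finset.range (l r), (a - j + ((Finset.range (r + 1)).filter (fun t => j < l t)).card)
        = ∏ j ∈ Finset.range (l r), (a + r + 1 - j) :=
      Finset.prod_congr rfl fun j hj => by
        have := Finset.mem_range.1 hj
        rw [hc _ _ le_rfl this]; omega
    have e2 : ∏ j ∈ Finset.range (l r), (a - j + ((Finset.range r).filter (fun t => j < l t)).card)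
        = ∏ j ∈ Finset.range (l r), (a + r - j) :=
      Finset.prod_congr rfl fun j hj => by
        have := Finset.mem_range.1 hj
        rw [hc _ _ (by omega) this]; omega
    have e3 : ∏ j ∈ Finset.Ico (l r) a, (a - j + ((Finset.range (r + 1)).filter (fun t => j < l t)).card)
        = ∏ j ∈ Finset.Ico (l r) a, (a - j + ((Finset.range r).filter (fun t => j < l t)).card) :=
      Finset.prod_congr rfl fun j hj => by
        have := Finset.mem_Ico.1 hj
        rw [hd _ (by omega)]
    rw [e2] at ih
    rw [e1, e3, Finset.prod_range_succ]
    have ht := telescope_prod (a + r) (l r) (by omega)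
    have e4 : a - l r + r + 1 = a + r + 1 - l r := by omega
    rw [e4, ← add_assoc, Nat.factorial_succ, ← ih]
    calc _ = ((∏ j ∈ Finset.range (l r), (a + r + 1 - j)) * (a + r + 1 - l r)) *
        ((∏ j ∈ Finset.Ico (l r) a, (a - j + ((Finset.range r).filter (fun t => j < l t)).card)) *
          ∏ t ∈ Finset.range r, (a - l t + t + 1)) := by ring
      _ = _ := by rw [ht]; ring

/-- The shifted parts. -/
def shiftK (N : ℕ) (l : ℕ → ℕ) : Fin N → ℕ := fun i => l i + (N - 1 - (i : ℕ))

noncomputable def dlt {N : ℕ} (v : Fin N → ℂ) : ℂ := ∏ i : Fin N, ∏ j ∈ Finset.Ioi i, (v i - v j)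

theorem prod_Ioi_eq {N : ℕ} (i : Fin N) (g : ℕ → ℂ) :
    ∏ j ∈ Finset.Ioi i, g j = ∏ t ∈ Finset.range (N - 1 - i), g (i + 1 + t) := by
  have hN : N - 1 - (i : ℕ) = N - (i + 1) := by omega
  rw [hN, ← Finset.prod_Ico_eq_prod_range]
  have : ∏ j ∈ Finset.Ico ((i : ℕ) + 1) N, g j = ∏ j ∈ Finset.Ioi i, g j := by
    refine Eq.trans ?_ (Finset.prod_map (Finset.Ioi i) Fin.valEmbedding g)
    congr 1
    ext j
    simp only [Finset.mem_Ico, Finset.mem_map, Finset.mem_Ioi, Fin.valEmbedding_apply]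
    constructor
    · rintro ⟨h1, h2⟩
      exact ⟨⟨j, h2⟩, by rw [Fin.lt_def]; exact h1, rfl⟩
    · rintro ⟨a, ha, rfl⟩
      exact ⟨ha, a.2⟩
  rw [← this]

theorem hook_formula (N : ℕ) (l : ℕ → ℕ) (hl : ∀ i j, i ≤ j → j < N → l j ≤ l i) :
    (hookProd N l : ℂ) * dlt (fun i => (shiftK N l i : ℂ)) = ∏ i : Fin N, ((shiftK N l i).factorial : ℂ) := by
  unfold hookProd dlt
  rw [← Fin.prod_univ_eq_prod_range]
  push_cast
  rw [← Finset.prod_mul_distrib]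
  refine Finset.prod_congr rfl fun i _ => ?_
  have h := hook_row (l i) (fun t => l (i + 1 + t)) (N - 1 - i)
    (fun t ht => hl _ _ (by omega) (by omega)) (fun t u htu hu => hl _ _ (by omega) (by omega))
  have e : shiftK N l i = l i + (N - 1 - (i : ℕ)) := rfl
  rw [e, ← h]
  push_cast
  congr 1
  · refine Finset.prod_congr rfl fun j hj => ?_
    rw [Nat.cast_sub (Finset.mem_range.1 hj).le]
    congr 2
    have : Finset.Ico ((i : ℕ) + 1) N = (Finset.range (N - 1 - i)).map (addLeftEmbedding ((i : ℕ) + 1)) := by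
      have := i.2
      rw [Finset.range_eq_Ico, Finset.map_add_left_Ico]
      congr 1
      omega
    rw [this, Finset.filter_map, Finset.card_map]
    rfl
  · have := prod_Ioi_eq i (fun j => ((l i + (N - 1 - i : ℕ) : ℕ) : ℂ) - ((l j + (N - 1 - j) : ℕ) : ℂ))
    refine Eq.trans ?_ (this.trans ?_)
    · refine Finset.prod_congr rfl fun t ht => ?_
      simp [shiftK]
    · refine Finset.prod_congr rfl fun t ht => ?_
      have ht := Finset.mem_range.1 ht
      have h3 : l (i + 1 + t) ≤ l i := hl _ _ (by omega) (by omega)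
      have h4 : l i + (N - 1 - (i : ℕ)) = (l i - l (i + 1 + t) + t + 1) + (l (i + 1 + t) + (N - 1 - (i + 1 + t))) := by
        omega
      rw [h4]
      push_cast [h3]
      ring

theorem shiftK_strictAnti (N : ℕ) (l : ℕ → ℕ) (hl : ∀ i j, i ≤ j → j < N → l j ≤ l i) :
    StrictAnti (shiftK N l) := by
  intro i j hij
  have hij' : (i : ℕ) < j := hij
  have := hl i j hij'.le j.2
  simp only [shiftK]
  omega

theorem dlt_ne_zero {N : ℕ} (v : Fin N → ℂ) (hv : Function.Injective v) : dlt v ≠ 0 := by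
  unfold dlt
  refine Finset.prod_ne_zero_iff.2 fun i _ => Finset.prod_ne_zero_iff.2 fun j hj => ?_
  rw [sub_ne_zero]
  intro h
  exact (Finset.mem_Ioi.1 hj).ne (hv h)

theorem dlt_eq_det {N : ℕ} : ∃ ε : ℂ, ε ≠ 0 ∧ ∀ v : Fin N → ℂ, dlt v = ε * (Matrix.vandermonde v).det := by
  refine ⟨∏ i : Fin N, ∏ j ∈ Finset.Ioi i, (-1), by simp [Finset.prod_ne_zero_iff], fun v => ?_⟩
  rw [Matrix.det_vandermonde, dlt, ← Finset.prod_mul_distrib]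
  refine Finset.prod_congr rfl fun i _ => ?_
  rw [← Finset.prod_mul_distrib]
  exact Finset.prod_congr rfl fun j _ => by ring

theorem dlt_perm {N : ℕ} (v : Fin N → ℂ) (σ : Equiv.Perm (Fin N)) :
    dlt (fun i => v (σ i)) = (Equiv.Perm.sign σ : ℤ) * dlt v := by
  obtain ⟨ε, -, h⟩ := dlt_eq_det (N := N)
  rw [h, h]
  have : Matrix.vandermonde (fun i => v (σ i)) = (Matrix.vandermonde v).submatrix σ id := by
    ext i j; simp [Matrix.vandermonde]
  rw [this, Matrix.det_permute]
  ring

theorem dlt_not_inj {N : ℕ} (v : Fin N → ℂ) (hv : ¬ Function.Injective v) : dlt v = 0 := by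
  obtain ⟨ε, -, h⟩ := dlt_eq_det (N := N)
  rw [h]
  have : (Matrix.vandermonde v).det = 0 := by
    by_contra h0
    exact hv (Matrix.det_vandermonde_ne_zero_iff.1 h0)
  rw [this, mul_zero]

theorem dlt_add {N : ℕ} (v : Fin N → ℂ) (c : ℂ) : dlt (fun i => v i + c) = dlt v := by
  simp [dlt]

theorem dlt_append {m n : ℕ} (x : Fin m → ℂ) (y : Fin n → ℂ) :
    dlt (Fin.append x y) = dlt x * dlt y * ∏ i : Fin m, ∏ j : Fin n, (x i - y j) := by
  have key : ∀ {N : ℕ} (v : Fin N → ℂ), dlt v = ∏ i, ∏ j, if i < j then v i - v j else 1 := by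
    intro N v
    unfold dlt
    refine Finset.prod_congr rfl fun i _ => ?_
    rw [← Finset.prod_filter]
    congr 1
    ext j; simp
  rw [key, key, key, Fin.prod_univ_add]
  simp only [Fin.prod_univ_add, Fin.append_left, Fin.append_right, Finset.prod_mul_distrib]
  have h1 : ∀ (i : Fin m) (j : Fin n), Fin.castAdd n i < Fin.natAdd m j := by
    intro i j; simp [Fin.lt_def]; omega
  have h2 : ∀ (i : Fin m) (j : Fin n), ¬ Fin.natAdd m j < Fin.castAdd n i := by
    intro i j; simp [Fin.lt_def]; omega
  simp only [h1, h2, if_true, if_false, Finset.prod_const_one, one_mul]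
  have h3 : ∀ i j : Fin m, (Fin.castAdd n i < Fin.castAdd n j) ↔ i < j := fun i j => Iff.rfl
  have h4 : ∀ i j : Fin n, (Fin.natAdd m i < Fin.natAdd m j) ↔ i < j := by intro i j; simp
  simp only [h3, h4]
  ring

/-- Reindexing of injective tuples. -/
theorem part_inj (N : ℕ) : Function.Injective
    (fun p : PartLE N × Equiv.Perm (Fin N) => fun i => shiftK N p.1.1 (p.2 i)) := by
  rintro ⟨l, σ⟩ ⟨l', σ'⟩ h
  have ha : ∀ l : PartLE N, StrictAnti (shiftK N l.1) := fun l =>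
    shiftK_strictAnti N l.1 (fun i j hij _ => l.2.1 hij)
  have h' : ∀ i, shiftK N l.1 (σ i) = shiftK N l'.1 (σ' i) := fun i => congrFun h i
  have hr : shiftK N l.1 = shiftK N l'.1 := by
    have hm : ∀ l : PartLE N, StrictMono (fun i => shiftK N l.1 (Fin.rev i)) :=
      fun l i j hij => ha l (Fin.rev_lt_rev.2 hij)
    have := (StrictMono.range_inj (hm l) (hm l')).1 (by
      ext v
      simp only [Set.mem_range]
      constructor
      · rintro ⟨i, rfl⟩
        refine ⟨Fin.rev (σ' (σ.symm (Fin.rev i))), ?_⟩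
        rw [Fin.rev_rev, ← h']; simp
      · rintro ⟨i, rfl⟩
        refine ⟨Fin.rev (σ (σ'.symm (Fin.rev i))), ?_⟩
        rw [Fin.rev_rev, h']; simp)
    ext i
    have := congrFun this (Fin.rev i)
    simpa using this
  have hl : l = l' := by
    apply Subtype.ext
    ext i
    by_cases hi : i < N
    · have := congrFun hr ⟨i, hi⟩
      simpa [shiftK] using this
    · rw [l.2.2 i (by omega), l'.2.2 i (by omega)]
  subst hl
  have : σ = σ' := by
    ext i
    rw [(ha l).injective (h' i)]
  rw [this]

theorem part_surj (N : ℕ) (K : Fin N → ℕ) (hK : Function.Injective K) : K ∈ Set.range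
    (fun p : PartLE N × Equiv.Perm (Fin N) => fun i => shiftK N p.1.1 (p.2 i)) := by
  let τ : Equiv.Perm (Fin N) := Fin.revPerm.trans (Tuple.sort K)
  have hmono : StrictAnti (fun i => K (τ i)) := by
    have h1 : StrictMono (K ∘ Tuple.sort K) :=
      (Tuple.monotone_sort K).strictMono_of_injective (hK.comp (Tuple.sort K).injective)
    intro i j hij
    exact h1 (Fin.rev_lt_rev.2 hij)
  have hge : ∀ (d : ℕ) (i j : Fin N), (j : ℕ) = i + d → K (τ j) + d ≤ K (τ i) := by
    intro d
    induction d with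
    | zero => intro i j h; have : i = j := Fin.ext (by omega); simp [this]
    | succ d ih =>
      intro i j h
      have h1 := ih i ⟨i + d, by omega⟩ rfl
      have h2 : K (τ j) < K (τ ⟨i + d, by omega⟩) := hmono (by rw [Fin.lt_def]; simp only []; omega)
      omega
  let l : ℕ → ℕ := fun i => if h : i < N then K (τ ⟨i, h⟩) - (N - 1 - i) else 0
  have hl : ∀ i : Fin N, l i + (N - 1 - i) = K (τ i) := by
    intro i
    have hi := i.2
    have := hge (N - 1 - i) i ⟨N - 1, by omega⟩ (by simp only []; omega)
    simp only [l, i.2, dif_pos, Fin.eta]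
    omega
  refine ⟨(⟨l, ?_, ?_⟩, τ.symm), ?_⟩
  · intro i j hij
    by_cases hj : j < N
    · have hi : i < N := by omega
      have := hge (j - i) ⟨i, hi⟩ ⟨j, hj⟩ (by simp; omega)
      simp only [l, hi, hj, dif_pos]
      omega
    · simp [l, hj]
  · intro i hi
    simp [l, show ¬ i < N by omega]
  · ext i
    simp only [shiftK]
    rw [hl]
    simp

theorem prodSum {κ : Type} (n : ℕ) : ∀ (a : Fin n → κ → ℂ), (∀ i, Summable (fun k => ‖a i k‖)) →
    Summable (fun K : Fin n → κ => ‖∏ i, a i (K i)‖) ∧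
    HasSum (fun K : Fin n → κ => ∏ i, a i (K i)) (∏ i, ∑' k, a i k) := by
  induction n with
  | zero =>
    intro a _
    constructor
    · exact (hasSum_unique _).summable
    · simpa using hasSum_unique (fun K : Fin 0 → κ => ∏ i, a i (K i))
  | succ n ih =>
    intro a ha
    obtain ⟨h1, h2⟩ := ih (fun i => a i.succ) (fun i => ha i.succ)
    have key : (fun p : κ × (Fin n → κ) => a 0 p.1 * ∏ i : Fin n, a i.succ (p.2 i)) =
        (fun K : Fin (n + 1) → κ => ∏ i, a i (K i)) ∘ (Fin.consEquiv (fun _ => κ)) := by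
      ext p
      simp [Fin.prod_univ_succ, Fin.consEquiv]
    have hs := (ha 0).mul_norm h1
    constructor
    · rw [← (Fin.consEquiv (fun _ => κ)).summable_iff]
      convert hs using 1
      ext p
      have := congrFun key p
      simp only [Function.comp] at this ⊢
      rw [← this]
    · rw [← (Fin.consEquiv (fun _ => κ)).hasSum_iff, ← key, Fin.prod_univ_succ]
      have h3 : HasSum (fun k => a 0 k) (∑' k, a 0 k) := (ha 0).of_norm.hasSum
      have h4 : Summable (fun p : κ × (Fin n → κ) => a 0 p.1 * ∏ i : Fin n, a i.succ (p.2 i)) :=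
        Summable.of_norm hs
      exact HasSum.mul (f := fun k => a 0 k)
        (g := fun K : Fin n → κ => ∏ i : Fin n, a i.succ (K i)) h3 h2 h4

theorem det_poly_cols (m n : ℕ) (B : Fin m → Fin m → ℂ) (v : Fin m → ℂ) (p : ℕ → Polynomial ℂ)
    (hp : ∀ a, (p a).Monic) (hd : ∀ a, (p a).natDegree = a) :
    (Matrix.of fun i j : Fin m => if (j : ℕ) < n then B i j else (p (j - n)).eval (v i)).det =
    (Matrix.of fun i j : Fin m => if (j : ℕ) < n then B i j else (v i) ^ ((j : ℕ) - n)).det := by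
  let A : Matrix (Fin m) (Fin m) ℂ :=
    Matrix.of fun i j : Fin m => if (j : ℕ) < n then B i j else (v i) ^ ((j : ℕ) - n)
  let C : Matrix (Fin m) (Fin m) ℂ := Matrix.of fun j' j : Fin m =>
    if (j : ℕ) < n then (if j' = j then 1 else 0) else
      (if n ≤ (j' : ℕ) then (p (j - n)).coeff (j' - n) else 0)
  have hC : C.det = 1 := by
    rw [Matrix.det_of_isUpperTriangular]
    · apply Finset.prod_eq_one
      intro j _
      simp only [C, Matrix.of_apply, if_true]
      split_ifs with h1 h2
      · rfl
      · have := (hp (j - n)).coeff_natDegree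
        rwa [hd] at this
      · omega
    · intro i j hij
      have hij' : (j : ℕ) < i := hij
      simp only [C, Matrix.of_apply, Fin.ext_iff]
      split_ifs with h1 h2 h3
      · omega
      · rfl
      · apply Polynomial.coeff_eq_zero_of_natDegree_lt
        rw [hd]; omega
      · rfl
  have hAC : A * C = Matrix.of fun i j : Fin m =>
      if (j : ℕ) < n then B i j else (p (j - n)).eval (v i) := by
    ext i j
    rw [Matrix.mul_apply]
    simp only [C, Matrix.of_apply]
    by_cases h : (j : ℕ) < n
    · simp [h, A]
    · simp only [h, if_false, A, Matrix.of_apply]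
      have hj := j.2
      rw [Polynomial.eval_eq_sum_range' (n := m - n) (by rw [hd]; omega)]
      have e1 : ∀ j' : Fin m, ((if (j' : ℕ) < n then B i j' else v i ^ ((j' : ℕ) - n)) *
          if n ≤ (j' : ℕ) then (p (j - n)).coeff (j' - n) else 0) =
          (fun b : ℕ => if n ≤ b then (p (j - n)).coeff (b - n) * v i ^ (b - n) else 0) j' := by
        intro j'
        by_cases h' : n ≤ (j' : ℕ)
        · simp [h', show ¬ (j' : ℕ) < n by omega, mul_comm]
        · simp [h']
      rw [Finset.sum_congr rfl fun j' _ => e1 j', 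
        Fin.sum_univ_eq_sum_range (fun b : ℕ => if n ≤ b then (p (j - n)).coeff (b - n) * v i ^ (b - n) else 0) m,
        ← Finset.sum_filter]
      have e2 : (Finset.range m).filter (fun b => n ≤ b) = Finset.Ico n m := by
        ext b; simp; omega
      rw [e2, Finset.sum_Ico_eq_sum_range]
      exact Finset.sum_congr rfl fun b _ => by simp
  rw [← hAC, Matrix.det_mul, hC, mul_one]

noncomputable def pol (s : ℕ) : ℕ → Polynomial ℂ
  | 0 => 1
  | 1 => Polynomial.X
  | (a + 2) => (Polynomial.X ^ 2 - Polynomial.C ((s : ℂ) ^ 2 / 4)) * (pol s a).comp (Polynomial.X - Polynomial.C 1)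

theorem pol_monic (s : ℕ) : ∀ a, (pol s a).Monic ∧ (pol s a).natDegree = a
  | 0 => by simp [pol]
  | 1 => by simp [pol]
  | (a + 2) => by
    obtain ⟨h1, h2⟩ := pol_monic s a
    have h3 : (Polynomial.X ^ 2 - Polynomial.C ((s : ℂ) ^ 2 / 4)).Monic :=
      Polynomial.monic_X_pow_sub_C _ two_ne_zero
    have h4 : ((pol s a).comp (Polynomial.X - Polynomial.C 1)).Monic := 
      h1.comp (Polynomial.monic_X_sub_C 1) (by rw [Polynomial.natDegree_X_sub_C]; exact one_ne_zero)
    constructor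
    · exact h3.mul h4
    · rw [pol, h3.natDegree_mul h4, Polynomial.natDegree_X_pow_sub_C, Polynomial.natDegree_comp, h2,
        Polynomial.natDegree_X_sub_C]
      ring

noncomputable def W (s : ℕ) (x : ℂ) (k : ℕ) : ℂ := x ^ k / (k.factorial * (k + s).factorial)

theorem W_succ (s : ℕ) (x : ℂ) (k : ℕ) : ((k : ℂ) + 1) * (k + 1 + s) * W s x (k + 1) = x * W s x k := by
  unfold W
  have h1 : ((k.factorial : ℕ) : ℂ) ≠ 0 := by exact_mod_cast k.factorial_ne_zero
  have h2 : (((k + s).factorial : ℕ) : ℂ) ≠ 0 := by exact_mod_cast (k + s).factorial_ne_zero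
  have h3 : (k : ℂ) + 1 ≠ 0 := by exact_mod_cast k.succ_ne_zero
  have h4 : (k : ℂ) + 1 + s ≠ 0 := by
    have : ((k + 1 + s : ℕ) : ℂ) ≠ 0 := by exact_mod_cast (by omega)
    simpa using this
  have e : k + 1 + s = (k + s) + 1 := by ring
  rw [e, Nat.factorial_succ, Nat.factorial_succ]
  push_cast
  have h5 : (k : ℂ) + s + 1 ≠ 0 := by convert h4 using 1; ring
  field_simp
  ring

theorem W_norm (s : ℕ) (x : ℂ) (k : ℕ) : ‖W s x k‖ ≤ ‖x‖ ^ k / k.factorial := by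
  unfold W
  rw [norm_div, norm_mul, norm_pow, Complex.norm_natCast, Complex.norm_natCast]
  have h1 : (0 : ℝ) < k.factorial := by exact_mod_cast k.factorial_pos
  have h2 : (1 : ℝ) ≤ (k + s).factorial := by exact_mod_cast (k + s).factorial_pos
  gcongr
  nlinarith

noncomputable def tq (s a : ℕ) (x : ℂ) (k : ℕ) : ℂ := (pol s a).eval ((k : ℂ) + s / 2) * W s x k

theorem tq_shift (s a : ℕ) (x : ℂ) (k : ℕ) : tq s (a + 2) x (k + 1) = x * tq s a x k := by
  unfold tq
  have := W_succ s x k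
  have e : ((k + 1 : ℕ) : ℂ) + s / 2 - 1 = k + s / 2 := by push_cast; ring
  rw [pol, Polynomial.eval_mul, Polynomial.eval_comp]
  simp only [Polynomial.eval_sub, Polynomial.eval_pow, Polynomial.eval_X, Polynomial.eval_C, e]
  push_cast
  linear_combination (Polynomial.eval ((k : ℂ) + s / 2) (pol s a)) * this

theorem tq_zero (s a : ℕ) (x : ℂ) : tq s (a + 2) x 0 = 0 := by
  unfold tq
  rw [pol, Polynomial.eval_mul]
  simp
  left; left; ring

theorem tq_summable (s : ℕ) (x : ℂ) : ∀ a, Summable (fun k => ‖tq s a x k‖)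
  | 0 => by
    refine Summable.of_nonneg_of_le (fun _ => norm_nonneg _) (fun k => ?_)
      (Real.summable_pow_div_factorial ‖x‖)
    simpa [tq, pol] using W_norm s x k
  | 1 => by
    refine Summable.of_nonneg_of_le (fun _ => norm_nonneg _) (fun k => ?_)
      (Real.summable_pow_div_factorial ‖x‖)
    simp only [tq, pol, Polynomial.eval_X, W]
    have e : (k : ℂ) + s / 2 = ((k + s / 2 : ℝ) : ℂ) := by push_cast; rfl
    rw [e, norm_mul, norm_div, norm_mul, norm_pow, Complex.norm_natCast, Complex.norm_natCast,
      Complex.norm_real, Real.norm_of_nonneg (by positivity)]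
    have h1 : (0 : ℝ) < k.factorial := by exact_mod_cast k.factorial_pos
    have h2 : (k + s : ℝ) ≤ (k + s).factorial := by exact_mod_cast Nat.self_le_factorial (k + s)
    have h3 : (0 : ℝ) < (k + s).factorial := by exact_mod_cast Nat.factorial_pos (k + s)
    have h4 : (k + s / 2 : ℝ) / (k + s).factorial ≤ 1 := by
      rw [div_le_one h3]
      have : (0 : ℝ) ≤ s := by positivity
      linarith
    calc _ = ((k + s / 2 : ℝ) / (k + s).factorial) * (‖x‖ ^ k / k.factorial) := by
          field_simp
      _ ≤ 1 * (‖x‖ ^ k / k.factorial) := by gcongr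
      _ = _ := one_mul _
  | (a + 2) => by
    rw [← summable_nat_add_iff 1]
    simp only [tq_shift, norm_mul]
    exact (tq_summable s x a).mul_left _

noncomputable def qf (s a : ℕ) (x : ℂ) : ℂ := ∑' k, tq s a x k

theorem qf_step (s a : ℕ) (x : ℂ) : qf s (a + 2) x = x * qf s a x := by
  unfold qf
  rw [(tq_summable s x (a + 2)).of_norm.tsum_eq_zero_add, tq_zero, zero_add]
  simp only [tq_shift]
  exact tsum_mul_left

noncomputable def tF (s : ℕ) (x y : ℂ) (p : ℕ × ℕ) : ℂ :=
  W s x p.1 * W s y p.2 / ((p.1 : ℂ) + p.2 + s + 1)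

noncomputable def FF (s : ℕ) (x y : ℂ) : ℂ := ∑' p, tF s x y p

theorem tF_summable (s : ℕ) (x y : ℂ) : Summable (fun p => ‖tF s x y p‖) := by
  have h := (tq_summable s x 0).mul_norm (tq_summable s y 0)
  refine Summable.of_nonneg_of_le (fun _ => norm_nonneg _) (fun p => ?_) h
  simp only [tF, tq, pol, Polynomial.eval_one, one_mul]
  rw [norm_div]
  apply div_le_self (norm_nonneg _)
  have : (p.1 : ℂ) + p.2 + s + 1 = ((p.1 + p.2 + s + 1 : ℕ) : ℂ) := by push_cast; rfl
  rw [this, Complex.norm_natCast]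
  exact_mod_cast (by omega)

theorem FF_half (s : ℕ) (x y : ℂ) : HasSum (fun p : ℕ × ℕ =>
    (p.1 : ℂ) * (p.1 + s) / (p.1 + p.2 + s) * (W s x p.1 * W s y p.2)) (x * FF s x y) := by
  have h := (tF_summable s x y).of_norm.hasSum.mul_left x
  have hi : Function.Injective (fun p : ℕ × ℕ => (p.1 + 1, p.2)) := by
    rintro ⟨a, b⟩ ⟨c, d⟩ h
    simp at h
    simp [h]
  rw [← hi.hasSum_iff]
  · refine Eq.mp ?_ h
    congr 1
    funext p
    simp only [Function.comp, tF]
    have := W_succ s x p.1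
    push_cast
    have e : (p.1 : ℂ) + 1 + p.2 + s = p.1 + p.2 + s + 1 := by ring
    rw [e]
    linear_combination -(W s y p.2 / (p.1 + p.2 + s + 1)) * this
  · rintro ⟨a, b⟩ hab
    cases a with
    | zero => simp
    | succ a => exact absurd ⟨(a, b), rfl⟩ hab

theorem FF_eq (s : ℕ) (x y : ℂ) :
    FF s x y * (x - y) = qf s 1 x * qf s 0 y - qf s 0 x * qf s 1 y := by
  have h1 := FF_half s x y
  have h2 := FF_half s y x
  have hsym : FF s y x = FF s x y := by
    unfold FF
    rw [← (Equiv.prodComm ℕ ℕ).tsum_eq]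
    refine tsum_congr fun p => ?_
    simp [tF]
    ring
  rw [hsym, ← (Equiv.prodComm ℕ ℕ).hasSum_iff] at h2
  have h3 := h1.sub h2
  have g1 := (tq_summable s x 1).of_norm.hasSum.mul (tq_summable s y 0).of_norm.hasSum
    ((tq_summable s x 1).mul_norm (tq_summable s y 0)).of_norm
  have g2 := (tq_summable s x 0).of_norm.hasSum.mul (tq_summable s y 1).of_norm.hasSum
    ((tq_summable s x 0).mul_norm (tq_summable s y 1)).of_norm
  have g3 := g1.sub g2
  have := h3.unique (by
    convert g3 using 1
    ext p
    simp only [Function.comp, Equiv.prodComm_apply, Prod.fst_swap, Prod.snd_swap, tq, pol,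
      Polynomial.eval_X, Polynomial.eval_one]
    by_cases h0 : (p.1 : ℂ) + p.2 + s = 0
    · have h0' : p.1 + p.2 + s = 0 := by exact_mod_cast h0
      have ea : p.1 = 0 := by omega
      have eb : p.2 = 0 := by omega
      have ec : s = 0 := by omega
      simp [ea, eb, ec]
    · have h0' : (p.2 : ℂ) + p.1 + s ≠ 0 := by rwa [add_comm (p.2 : ℂ)]
      field_simp
      ring)
  unfold qf
  rw [← this]
  ring

theorem det_hasSum {N : ℕ} (T : Fin N → Fin N → ℕ → ℂ) (hT : ∀ r a, Summable fun k => ‖T r a k‖) :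
    HasSum (fun K : Fin N → ℕ => (Matrix.of fun r a => T r a (K r)).det)
      (Matrix.of fun r a => ∑' k, T r a k).det := by
  simp only [← Matrix.det_transpose (Matrix.of _)]
  simp only [Matrix.det_apply, Matrix.transpose_apply, Matrix.of_apply]
  refine hasSum_sum fun σ _ => ?_
  refine HasSum.const_smul _ ?_
  exact (prodSum N (fun r => T r (σ r)) (fun r => hT r (σ r))).2

theorem dlt_hasSum (s N : ℕ) (δ : ℂ)
    (hδ : ∀ v : Fin N → ℂ, dlt v = δ * (Matrix.vandermonde v).det) (z : Fin N → ℂ) :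
    HasSum (fun K : Fin N → ℕ => dlt (fun i => (K i : ℂ)) * ∏ i, W s (z i) (K i))
      (δ * (Matrix.of fun r a : Fin N => qf s a (z r)).det) := by
  have h := (det_hasSum (fun (r a : Fin N) k => tq s a (z r) k)
    (fun r a => tq_summable s (z r) a)).mul_left δ
  refine Eq.mp ?_ h
  congr 1
  funext K
  rw [← dlt_add _ ((s : ℂ) / 2), hδ, mul_assoc]
  congr 1
  have e1 : (Matrix.of fun r a : Fin N => tq s a (z r) (K r)) = Matrix.of fun r a : Fin N =>
      W s (z r) (K r) * (Matrix.of fun r a : Fin N => (pol s a).eval ((K r : ℂ) + s / 2)) r a := by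
    ext r a
    simp [tq, mul_comm]
  rw [e1, Matrix.det_mul_column, mul_comm]
  congr 1
  have := det_poly_cols N 0 (fun _ _ => 0) (fun r => (K r : ℂ) + s / 2) (pol s)
    (fun a => (pol_monic s a).1) (fun a => (pol_monic s a).2)
  simp only [Nat.not_lt_zero, if_false, Nat.sub_zero] at this
  rw [this]
  rfl

theorem cauchy_mix (s m n : ℕ) (ε δ : ℂ)
    (h : ∀ (P : Type) (F : P → P → ℂ) (q : ℕ → P → ℂ) (X : P → ℂ)
      (_ : ∀ u v, F u v * (X u - X v) = q 1 u * q 0 v - q 0 u * q 1 v)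
      (_ : ∀ a u, q (a + 2) u = X u * q a u) (x : Fin m → P) (y : ℕ → P),
      (∏ i : Fin m, ∏ j : Fin n, (X (x i) - X (y j))) * (mixM F q m n x y).det =
      ε * (Matrix.of fun r a : Fin (m + n) =>
        q a (Fin.append x (fun j : Fin n => y j) r)).det)
    (hδ : ∀ v : Fin (m + n) → ℂ, dlt v = δ * (Matrix.vandermonde v).det)
    (k : Fin m → ℕ) (l : ℕ → ℕ) :
    δ * ((∏ i : Fin m, ∏ j : Fin n, ((k i : ℂ) + l j + s + 1)) *
      (Matrix.of fun i j : Fin m => if (j : ℕ) < n then 1 / ((k i : ℂ) + l j + s + 1) else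
        (pol s (j - n)).eval ((k i : ℂ) + s / 2)).det) =
    ε * (dlt (fun i => (k i : ℂ)) * dlt (fun j : Fin n => (l j : ℂ))) := by
  rw [det_poly_cols m n (fun i j => 1 / ((k i : ℂ) + l j + s + 1)) (fun i => (k i : ℂ) + s / 2) (pol s)
    (fun a => (pol_monic s a).1) (fun a => (pol_monic s a).2)]
  let L : ℝ → ℂ := fun η => δ * ((∏ i : Fin m, ∏ j : Fin n, ((k i : ℂ) + l j + s + 1 + η)) *
      (Matrix.of fun i j : Fin m => if (j : ℕ) < n then 1 / ((k i : ℂ) + l j + s + 1 + η) else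
        ((k i : ℂ) + s / 2) ^ ((j : ℕ) - n)).det)
  have hne : ∀ (η : ℝ) (i : Fin m) (j : ℕ), 0 ≤ η → (k i : ℂ) + l j + s + 1 + η ≠ 0 := by
    intro η i j hη
    have : (k i : ℂ) + l j + s + 1 + η = ((k i + l j + s + 1 + η : ℝ) : ℂ) := by push_cast; rfl
    rw [this, Complex.ofReal_ne_zero]
    positivity
  have hL : ContinuousAt L 0 := by
    refine ContinuousAt.mul continuousAt_const (ContinuousAt.mul ?_ ?_)
    · fun_prop
    · have : ContinuousAt (fun η : ℝ => (Matrix.of fun i j : Fin m => if (j : ℕ) < n then 1 / ((k i : ℂ) + l j + s + 1 + η) else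
        ((k i : ℂ) + s / 2) ^ ((j : ℕ) - n))) 0 := by
        refine continuousAt_pi.2 fun i => continuousAt_pi.2 fun j => ?_
        simp only [Matrix.of_apply]
        split_ifs
        · refine ContinuousAt.div continuousAt_const (by fun_prop) (hne 0 i j le_rfl)
        · exact continuousAt_const
      exact (continuous_id.matrix_det.continuousAt).comp this
  have hLc : ∀ η : ℝ, 0 < η → η < 1 →
      L η = ε * (dlt (fun i => (k i : ℂ)) * dlt (fun j : Fin n => (l j : ℂ))) := by
    intro η h0 h1
    obtain ⟨η', hη'⟩ : ∃ η' : NNReal, (η' : ℝ) = η := ⟨⟨η, h0.le⟩, rfl⟩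
    let x : Fin m → NNReal := fun i => k i + s / 2
    let y : ℕ → NNReal := fun j => l j + s / 2 + 1 + η'
    have hx : ∀ i, ((x i : ℝ) : ℂ) = k i + s / 2 := by intro i; simp [x]
    have hy : ∀ j, ((y j : ℝ) : ℂ) = l j + (s / 2 + 1 + η) := by
      intro j
      have : ((y j : ℝ)) = l j + s / 2 + 1 + η := by simp [y, hη']
      rw [this]; push_cast; ring
    have key := h NNReal (fun u v => 1 / (((u : ℝ) : ℂ) + ((v : ℝ) : ℂ))) (fun a u => ((u : ℝ) : ℂ) ^ a)
      (fun u => ((u : ℝ) : ℂ) ^ 2) (by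
        intro u v
        by_cases huv : ((u : ℝ) : ℂ) + ((v : ℝ) : ℂ) = 0
        · have h1 : (u : ℝ) + v = 0 := by exact_mod_cast huv
          have hu : (u : ℝ) = 0 := by have := u.2; have := v.2; simp only [NNReal.val_eq_coe] at *; linarith
          have hv : (v : ℝ) = 0 := by linarith
          simp [hu, hv]
        · field_simp
          ring) (by intro a u; ring) x y
    have hfac : (∏ i : Fin m, ∏ j : Fin n, (((x i : ℝ) : ℂ) ^ 2 - ((y j : ℝ) : ℂ) ^ 2)) =
        (∏ i : Fin m, ∏ j : Fin n, ((k i : ℂ) + l j + s + 1 + η)) *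
        (∏ i : Fin m, ∏ j : Fin n, (((x i : ℝ) : ℂ) - ((y j : ℝ) : ℂ))) := by
      rw [← Finset.prod_mul_distrib]
      refine Finset.prod_congr rfl fun i _ => ?_
      rw [← Finset.prod_mul_distrib]
      refine Finset.prod_congr rfl fun j _ => ?_
      rw [hx, hy]; ring
    have hvd : δ * (Matrix.of fun r a : Fin (m + n) =>
        (((Fin.append x (fun j : Fin n => y j) r : NNReal) : ℝ) : ℂ) ^ (a : ℕ)).det =
        dlt (fun i => (k i : ℂ)) * dlt (fun j : Fin n => (l j : ℂ)) *
        (∏ i : Fin m, ∏ j : Fin n, (((x i : ℝ) : ℂ) - ((y j : ℝ) : ℂ))) := by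
      have e1 := hδ (fun r => (((Fin.append x (fun j : Fin n => y j) r : NNReal) : ℝ) : ℂ))
      have e2 : (fun r => (((Fin.append x (fun j : Fin n => y j) r : NNReal) : ℝ) : ℂ)) =
          Fin.append (fun i => ((x i : ℝ) : ℂ)) (fun j : Fin n => ((y j : ℝ) : ℂ)) := by
        funext r
        refine Fin.addCases (fun i => ?_) (fun j => ?_) r <;> simp
      have e3 : dlt (fun i => ((x i : ℝ) : ℂ)) = dlt (fun i => (k i : ℂ)) := by
        simp only [hx]; exact dlt_add _ _
      have e4 : dlt (fun j : Fin n => ((y j : ℝ) : ℂ)) = dlt (fun j : Fin n => (l j : ℂ)) := by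
        simp only [hy]; exact dlt_add _ _
      rw [← e3, ← e4, ← dlt_append, ← e2, e1]
      rfl
    have hnz : (∏ i : Fin m, ∏ j : Fin n, (((x i : ℝ) : ℂ) - ((y j : ℝ) : ℂ))) ≠ 0 := by
      refine Finset.prod_ne_zero_iff.2 fun i _ => Finset.prod_ne_zero_iff.2 fun j _ => ?_
      rw [hx, hy]
      intro h2
      have h3 : (((k i : ℝ) - l j - 1 - η : ℝ) : ℂ) = 0 := by
        push_cast; linear_combination h2
      have h4 : (k i : ℝ) - l j - 1 - η = 0 := by exact_mod_cast h3
      have h5 : (((k i : ℤ) - l j - 1 : ℤ) : ℝ) = η := by push_cast; linarith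
      have h6 : (0 : ℤ) < (k i : ℤ) - l j - 1 := by
        have : (0 : ℝ) < (((k i : ℤ) - l j - 1 : ℤ) : ℝ) := by rw [h5]; exact h0
        exact_mod_cast this
      have h7 : (k i : ℤ) - l j - 1 < 1 := by
        have : (((k i : ℤ) - l j - 1 : ℤ) : ℝ) < 1 := by rw [h5]; exact h1
        exact_mod_cast this
      omega
    have hM : mixM (fun u v : NNReal => 1 / (((u : ℝ) : ℂ) + ((v : ℝ) : ℂ))) (fun a u => ((u : ℝ) : ℂ) ^ a) m n x y =
        (Matrix.of fun i j : Fin m => if (j : ℕ) < n then 1 / ((k i : ℂ) + l j + s + 1 + η) else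
        ((k i : ℂ) + s / 2) ^ ((j : ℕ) - n)) := by
      ext i j
      simp only [mixM, Matrix.of_apply, hx, hy]
      congr 2
      ring
    apply mul_right_cancel₀ hnz
    simp only [L]
    rw [hfac, hM] at key
    linear_combination δ * key + ε * hvd
  have hlim : Filter.Tendsto L (nhdsWithin 0 (Set.Ioi 0)) (nhds (L 0)) :=
    hL.tendsto.mono_left nhdsWithin_le_nhds
  have hev : ∀ᶠ η in nhdsWithin (0 : ℝ) (Set.Ioi 0),
      ε * (dlt (fun i => (k i : ℂ)) * dlt (fun j : Fin n => (l j : ℂ))) = L η := by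
    filter_upwards [Ioo_mem_nhdsGT (zero_lt_one (α := ℝ))] with η hη
    exact (hLc η hη.1 hη.2).symm
  have := tendsto_nhds_unique hlim (Filter.Tendsto.congr' hev tendsto_const_nhds)
  rw [← this]
  simp [L]

theorem prodSum_mul {κ κ' : Type} (n d : ℕ) (a : Fin n → κ → ℂ) (b : Fin d → κ' → ℂ)
    (ha : ∀ i, Summable (fun k => ‖a i k‖)) (hb : ∀ i, Summable (fun k => ‖b i k‖)) :
    HasSum (fun u : (Fin n → κ) × (Fin d → κ') => (∏ j, a j (u.1 j)) * ∏ j, b j (u.2 j))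
      ((∏ j, ∑' k, a j k) * ∏ j, ∑' k, b j k) := by
  obtain ⟨a1, a2⟩ := prodSum n a ha
  obtain ⟨b1, b2⟩ := prodSum d b hb
  generalize (∏ j, ∑' k, a j k) = A at *
  generalize (∏ j, ∑' k, b j k) = B at *
  let f : (Fin n → κ) → ℂ := fun u => ∏ j, a j (u j)
  let g : (Fin d → κ') → ℂ := fun u => ∏ j, b j (u j)
  have a1' : Summable (fun u => ‖f u‖) := a1
  have b1' : Summable (fun u => ‖g u‖) := b1
  have a2' : HasSum f A := a2
  have b2' : HasSum g B := b2
  change HasSum (fun u : (Fin n → κ) × (Fin d → κ') => f u.1 * g u.2) (A * B)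
  clear_value f g
  exact a2'.mul b2' (summable_mul_of_summable_norm a1' b1')

theorem mix_hasSum (s n d : ℕ) (x : Fin (n + d) → ℂ) (y : Fin n → ℂ) (y' : ℕ → ℂ)
    (hy : ∀ j : Fin n, y' j = y j) :
    HasSum (fun p : (Fin (n + d) → ℕ) × (Fin n → ℕ) =>
      (Matrix.of fun i j : Fin (n + d) => if h : (j : ℕ) < n then 1 / ((p.1 i : ℂ) + p.2 ⟨j, h⟩ + s + 1) else
        (pol s (j - n)).eval ((p.1 i : ℂ) + s / 2)).det *
        ((∏ i, W s (x i) (p.1 i)) * ∏ j, W s (y j) (p.2 j)))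
      (mixM (FF s) (qf s) (n + d) n x y').det := by
  have hterm : ∀ p : (Fin (n + d) → ℕ) × (Fin n → ℕ),
      (Matrix.of fun i j : Fin (n + d) => if h : (j : ℕ) < n then 1 / ((p.1 i : ℂ) + p.2 ⟨j, h⟩ + s + 1) else
        (pol s (j - n)).eval ((p.1 i : ℂ) + s / 2)).det *
        ((∏ i, W s (x i) (p.1 i)) * ∏ j, W s (y j) (p.2 j)) =
      ∑ σ : Equiv.Perm (Fin (n + d)), Equiv.Perm.sign σ •
        ((∏ j : Fin n, tF s (x (σ (Fin.castAdd d j))) (y j) (p.1 (σ (Fin.castAdd d j)), p.2 j)) *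
          ∏ a : Fin d, tq s a (x (σ (Fin.natAdd n a))) (p.1 (σ (Fin.natAdd n a)))) := by
    intro p
    rw [Matrix.det_apply, Finset.sum_mul]
    refine Finset.sum_congr rfl fun σ _ => ?_
    rw [smul_mul_assoc]
    congr 1
    rw [← Equiv.prod_comp σ (fun i => W s (x i) (p.1 i)), Fin.prod_univ_add, Fin.prod_univ_add]
    simp only [Matrix.of_apply, Fin.val_castAdd, Fin.val_natAdd, Fin.is_lt, dif_pos, Fin.eta,
      show ∀ a : ℕ, ¬ (n + a < n) by intro a; omega, dif_neg, not_false_eq_true,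
      Nat.add_sub_cancel_left, tF, tq, Finset.prod_mul_distrib, Finset.prod_div_distrib, Finset.prod_const_one]
    ring
  have hdet : (mixM (FF s) (qf s) (n + d) n x y').det =
      ∑ σ : Equiv.Perm (Fin (n + d)), Equiv.Perm.sign σ •
        ((∏ j : Fin n, ∑' u, tF s (x (σ (Fin.castAdd d j))) (y j) u) *
          ∏ a : Fin d, ∑' k, tq s a (x (σ (Fin.natAdd n a))) k) := by
    rw [Matrix.det_apply]
    refine Finset.sum_congr rfl fun σ _ => ?_
    congr 1
    rw [Fin.prod_univ_add]
    simp [mixM, hy, FF, qf]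
  rw [hdet]
  simp only [hterm]
  refine hasSum_sum fun σ _ => HasSum.const_smul _ ?_
  let e : (Fin (n + d) → ℕ) × (Fin n → ℕ) ≃ (Fin n → ℕ × ℕ) × (Fin d → ℕ) :=
    { toFun := fun p => (fun j => (p.1 (σ (Fin.castAdd d j)), p.2 j), fun a => p.1 (σ (Fin.natAdd n a)))
      invFun := fun u => (fun i => Fin.append (fun j => (u.1 j).1) u.2 (σ.symm i), fun j => (u.1 j).2)
      left_inv := by
        rintro ⟨k, l⟩
        refine Prod.ext ?_ rfl
        funext i
        obtain ⟨r, rfl⟩ := σ.surjective i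
        simp only [Equiv.symm_apply_apply]
        refine Fin.addCases (fun i => ?_) (fun j => ?_) r <;> simp
      right_inv := by
        rintro ⟨u, v⟩
        simp }
  exact (e.hasSum_iff (f := (fun u : (Fin n → ℕ × ℕ) × (Fin d → ℕ) =>
      (∏ j : Fin n, tF s (x (σ (Fin.castAdd d j))) (y j) (u.1 j)) *
      ∏ a : Fin d, tq s a (x (σ (Fin.natAdd n a))) (u.2 a)))).2
      (prodSum_mul n d (fun j => tF s (x (σ (Fin.castAdd d j))) (y j))
        (fun a => tq s a (x (σ (Fin.natAdd n a)))) (fun j => tF_summable _ _ _)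
        (fun a => tq_summable _ _ _))

/-- The coefficientwise form of the identity. -/
def Core (s m n : ℕ) : Prop := ∀ (x : Fin m → ℂ) (y : Fin n → ℂ), ∃ S : ℂ,
    HasSum (fun p : (Fin m → ℕ) × (Fin n → ℕ) =>
      dlt (fun i => (p.1 i : ℂ)) * dlt (fun j => (p.2 j : ℂ)) /
        (∏ i, ∏ j, ((p.1 i : ℂ) + p.2 j + s + 1)) *
        ((∏ i, W s (x i) (p.1 i)) * ∏ j, W s (y j) (p.2 j))) S ∧
    HasSum (fun p : (Fin m → ℕ) × (Fin n → ℕ) =>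
      dlt (fun i => (p.1 i : ℂ)) * dlt (fun j => (p.2 j : ℂ)) *
        (∏ i, ∏ j, ((p.1 i : ℂ) - p.2 j)) *
        ((∏ i, W s (x i) (p.1 i)) * ∏ j, W s (y j) (p.2 j)))
      ((∏ i, ∏ j, (x i - y j)) * S)

theorem den_ne_zero (s : ℕ) {m n : ℕ} (k : Fin m → ℕ) (l : Fin n → ℕ) :
    (∏ i, ∏ j, ((k i : ℂ) + l j + s + 1)) ≠ 0 := by
  refine Finset.prod_ne_zero_iff.2 fun i _ => Finset.prod_ne_zero_iff.2 fun j _ => ?_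
  have : (k i : ℂ) + l j + s + 1 = ((k i + l j + s + 1 : ℕ) : ℂ) := by push_cast; rfl
  rw [this]
  exact Nat.cast_ne_zero.2 (by omega)

theorem append_hasSum {m n : ℕ} (Φ : (Fin (m + n) → ℕ) → ℂ) (S : ℂ) :
    HasSum (fun p : (Fin m → ℕ) × (Fin n → ℕ) => Φ (Fin.append p.1 p.2)) S ↔ HasSum Φ S :=
  (Fin.appendEquiv m n (α := ℕ)).hasSum_iff (f := Φ)

theorem dlt_split (s : ℕ) {m n : ℕ} (z : Fin (m + n) → ℂ) (x : Fin m → ℂ) (y : Fin n → ℂ)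
    (hx : ∀ i, z (Fin.castAdd n i) = x i) (hy : ∀ j, z (Fin.natAdd m j) = y j)
    (k : Fin m → ℕ) (l : Fin n → ℕ) :
    dlt (fun i => ((Fin.append k l i : ℕ) : ℂ)) * ∏ i, W s (z i) (Fin.append k l i) =
    dlt (fun i => (k i : ℂ)) * dlt (fun j => (l j : ℂ)) *
        (∏ i, ∏ j, ((k i : ℂ) - l j)) *
        ((∏ i, W s (x i) (k i)) * ∏ j, W s (y j) (l j)) := by
  have e : (fun i => ((Fin.append k l i : ℕ) : ℂ)) = Fin.append (fun i => (k i : ℂ)) (fun j => (l j : ℂ)) := by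
    funext r
    refine Fin.addCases (fun i => ?_) (fun j => ?_) r <;> simp
  rw [e, dlt_append, Fin.prod_univ_add]
  simp only [Fin.append_left, Fin.append_right, hx, hy]

theorem core_ge (s n d : ℕ) : Core s (n + d) n := by
  intro x y
  obtain ⟨ε, hε, h⟩ := mix_append (n + d) n (by omega)
  obtain ⟨δ, hδ0, hδ⟩ := dlt_eq_det (N := n + d + n)
  let y' : ℕ → ℂ := fun j => if h : j < n then y ⟨j, h⟩ else 0
  have hy' : ∀ j : Fin n, y' j = y j := fun j => by simp [y']
  have key := h ℂ (FF s) (qf s) id (fun u v => FF_eq s u v) (fun a u => qf_step s a u) x y'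
  simp only [id, hy'] at key
  refine ⟨δ / ε * (mixM (FF s) (qf s) (n + d) n x y').det, ?_, ?_⟩
  · have h1 := (mix_hasSum s n d x y y' hy').mul_left (δ / ε)
    refine Eq.mp ?_ h1
    congr 1
    funext p
    let l' : ℕ → ℕ := fun j => if h : j < n then p.2 ⟨j, h⟩ else 0
    have hl' : ∀ j : Fin n, l' j = p.2 j := fun j => by simp [l']
    have hc := cauchy_mix s (n + d) n ε δ h hδ p.1 l'
    simp only [hl'] at hc
    have hM : (Matrix.of fun i j : Fin (n + d) => if h : (j : ℕ) < n then 1 / ((p.1 i : ℂ) + p.2 ⟨j, h⟩ + s + 1) else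
        (pol s (j - n)).eval ((p.1 i : ℂ) + s / 2)) =
        (Matrix.of fun i j : Fin (n + d) => if (j : ℕ) < n then 1 / ((p.1 i : ℂ) + l' j + s + 1) else
        (pol s (j - n)).eval ((p.1 i : ℂ) + s / 2)) := by
      ext i j
      simp only [Matrix.of_apply]
      split_ifs with hj
      · simp [l', hj]
      · rfl
    rw [hM, ← mul_assoc]
    congr 1
    have hR := den_ne_zero s p.1 p.2
    rw [eq_div_iff hR, div_mul_eq_mul_div, div_mul_eq_mul_div, div_eq_iff hε]
    linear_combination hc
  · have h2 := dlt_hasSum s _ δ hδ (Fin.append x y)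
    rw [← append_hasSum] at h2
    simp only [dlt_split s (Fin.append x y) x y (by simp) (by simp)] at h2
    refine Eq.mp ?_ h2
    congr 1
    have : (∏ i, ∏ j, (x i - y j)) * (δ / ε * (mixM (FF s) (qf s) (n + d) n x y').det) =
      δ / ε * ((∏ i, ∏ j, (x i - y j)) * (mixM (FF s) (qf s) (n + d) n x y').det) := by ring
    rw [this, key]
    field_simp

theorem core_swap (s m n : ℕ) (h : Core s m n) : Core s n m := by
  intro y x
  obtain ⟨S, h1, h2⟩ := h x y
  have flip : ∀ (a : Fin m → ℂ) (b : Fin n → ℂ), (∏ j, ∏ i, (b j - a i)) =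
      ((-1) ^ m) ^ n * ∏ i, ∏ j, (a i - b j) := by
    intro a b
    rw [Finset.prod_comm (f := fun i j => a i - b j)]
    have : (((-1 : ℂ)) ^ m) ^ n = ∏ j : Fin n, ∏ i : Fin m, (-1) := by simp
    rw [this, ← Finset.prod_mul_distrib]
    refine Finset.prod_congr rfl fun j _ => ?_
    rw [← Finset.prod_mul_distrib]
    exact Finset.prod_congr rfl fun i _ => by ring
  rw [← (Equiv.prodComm (Fin n → ℕ) (Fin m → ℕ)).hasSum_iff] at h1 h2
  refine ⟨S, ?_, ?_⟩
  · refine Eq.mp ?_ h1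
    congr 1
    funext p
    simp only [Function.comp, Equiv.prodComm_apply, Prod.fst_swap, Prod.snd_swap]
    rw [Finset.prod_comm, mul_comm (dlt _) (dlt _), mul_comm (∏ i, W s (x i) _)]
    congr 2
    refine Finset.prod_congr rfl fun j _ => Finset.prod_congr rfl fun i _ => by ring
  · have h3 := h2.mul_left (((-1 : ℂ) ^ m) ^ n)
    refine Eq.mp ?_ h3
    congr 1
    · funext p
      simp only [Function.comp, Equiv.prodComm_apply, Prod.fst_swap, Prod.snd_swap]
      rw [flip (fun i => (p.2 i : ℂ)) (fun j => (p.1 j : ℂ))]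
      ring
    · rw [flip]; ring

theorem core_all (s m n : ℕ) : Core s m n := by
  rcases le_total n m with h | h
  · obtain ⟨d, rfl⟩ := Nat.exists_eq_add_of_le h
    exact core_ge s n d
  · obtain ⟨d, rfl⟩ := Nat.exists_eq_add_of_le h
    exact core_swap s _ _ (core_ge s m d)

theorem part_sum (N : ℕ) (Φ : (Fin N → ℕ) → ℂ) (S : ℂ) (h : HasSum Φ S)
    (h0 : ∀ K, ¬ Function.Injective K → Φ K = 0) :
    HasSum (fun l : PartLE N => ∑ σ : Equiv.Perm (Fin N), Φ (fun i => shiftK N l.1 (σ i))) S := by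
  rw [← (part_inj N).hasSum_iff] at h
  · exact h.prod_fiberwise (fun l => hasSum_fintype _)
  · intro K hK
    exact h0 K fun hi => hK (part_surj N K hi)

theorem part_sum2 (m n : ℕ) (Φ : (Fin m → ℕ) × (Fin n → ℕ) → ℂ) (S : ℂ) (h : HasSum Φ S)
    (h1 : ∀ p, ¬ Function.Injective p.1 → Φ p = 0) (h2 : ∀ p, ¬ Function.Injective p.2 → Φ p = 0) :
    HasSum (fun p : PartLE m × PartLE n => ∑ τ : Equiv.Perm (Fin m) × Equiv.Perm (Fin n),
      Φ (fun i => shiftK m p.1.1 (τ.1 i), fun j => shiftK n p.2.1 (τ.2 j))) S := by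
  rw [← ((part_inj m).prodMap (part_inj n)).hasSum_iff] at h
  · rw [← (Equiv.prodProdProdComm (PartLE m) (PartLE n) (Equiv.Perm (Fin m))
      (Equiv.Perm (Fin n))).hasSum_iff] at h
    exact h.prod_fiberwise (fun l => hasSum_fintype _)
  · rintro ⟨k, l⟩ hK
    by_contra hne
    have a1 : Function.Injective k := by by_contra hk; exact hne (h1 _ hk)
    have a2 : Function.Injective l := by by_contra hk; exact hne (h2 _ hk)
    obtain ⟨u, hu⟩ := part_surj m k a1
    obtain ⟨v, hv⟩ := part_surj n l a2
    exact hK ⟨(u, v), Prod.ext hu hv⟩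

noncomputable def om (s : ℕ) {N : ℕ} (k : Fin N → ℕ) : ℂ :=
  ∏ i, (1 / ((k i).factorial * (k i + s).factorial : ℂ))

theorem antisym (s : ℕ) {N : ℕ} (z : Fin N → ℂ) (k : Fin N → ℕ) :
    ∑ σ : Equiv.Perm (Fin N), dlt (fun i => (k (σ i) : ℂ)) * ∏ i, W s (z i) (k (σ i)) =
      dlt (fun i => (k i : ℂ)) * om s k * (Matrix.of fun i j => z i ^ k j).det := by
  rw [← Matrix.det_transpose, Matrix.det_apply', Finset.mul_sum]
  refine Finset.sum_congr rfl fun σ _ => ?_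
  rw [dlt_perm (fun i => (k i : ℂ)) σ]
  have : ∏ i, W s (z i) (k (σ i)) = om s k * ∏ i, z i ^ k (σ i) := by
    rw [om, ← Equiv.prod_comp σ (fun i => (1 / ((k i).factorial * (k i + s).factorial : ℂ))), ← Finset.prod_mul_distrib]
    refine Finset.prod_congr rfl fun i _ => ?_
    rw [W]; ring
  rw [this]
  simp only [Matrix.transpose_apply, Matrix.of_apply]
  ring

theorem cast_not_inj {N : ℕ} (K : Fin N → ℕ) (h : ¬ Function.Injective K) :
    dlt (fun i => (K i : ℂ)) = 0 :=
  dlt_not_inj _ fun hi => h fun a b hab => hi (by simp [hab])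

theorem schurNorm_eq {N : ℕ} (z : Fin N → ℂ) (l : ℕ → ℕ) :
    schurNorm z l = ((Matrix.of fun i j => z i ^ shiftK N l j).det / dlt z) /
      (dlt (fun i => (shiftK N l i : ℂ)) / ∏ i ∈ Finset.range N, (i.factorial : ℂ)) := by
  unfold schurNorm dlt
  have : ∀ i : Fin N, (l i : ℂ) + ((N : ℂ) - 1 - ((i : ℕ) : ℂ)) = (shiftK N l i : ℂ) := by
    intro i
    have := i.2
    rw [shiftK]
    push_cast [show (i : ℕ) ≤ N - 1 by omega, show 1 ≤ N by omega]
    ring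
  simp only [this]
  rfl

theorem term_eq (s N : ℕ) (z : Fin N → ℂ) (l : PartLE N) :
    (1 / ((hookProd N l.1 : ℂ) *
            (hookProd N (fun i => if i < N then l.1 i + s else 0) : ℂ))) * schurNorm z l.1 =
    ((∏ i ∈ Finset.range N, (i.factorial : ℂ)) / dlt z) *
      (dlt (fun i => (shiftK N l.1 i : ℂ)) * om s (shiftK N l.1) *
        (Matrix.of fun i j => z i ^ shiftK N l.1 j).det) := by
  have hl : ∀ i j, i ≤ j → j < N → l.1 j ≤ l.1 i := fun i j hij _ => l.2.1 hij
  have f1 := hook_formula N l.1 hl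
  have f2 := hook_formula N (fun i => if i < N then l.1 i + s else 0) (by
    intro i j hij hj
    have := hl i j hij hj
    simp [hj, show i < N by omega, this])
  have hk : ∀ i, shiftK N (fun i => if i < N then l.1 i + s else 0) i = shiftK N l.1 i + s := by
    intro i
    simp [shiftK]; ring
  simp only [hk] at f2
  have hd : dlt (fun i => ((shiftK N l.1 i + s : ℕ) : ℂ)) = dlt (fun i => (shiftK N l.1 i : ℂ)) := by
    push_cast
    exact dlt_add _ _
  rw [hd] at f2
  have hD : dlt (fun i => (shiftK N l.1 i : ℂ)) ≠ 0 :=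
    dlt_ne_zero _ (fun a b hab => (shiftK_strictAnti N l.1 hl).injective (by exact_mod_cast hab))
  have hom : om s (shiftK N l.1) = 1 / ((∏ i, ((shiftK N l.1 i).factorial : ℂ)) *
      ∏ i, ((shiftK N l.1 i + s).factorial : ℂ)) := by
    rw [om, Finset.prod_div_distrib, Finset.prod_mul_distrib]; simp
  have g1 : (∏ i, ((shiftK N l.1 i).factorial : ℂ)) ≠ 0 :=
    Finset.prod_ne_zero_iff.2 fun i _ => by exact_mod_cast Nat.factorial_ne_zero _
  have g2 : (∏ i, ((shiftK N l.1 i + s).factorial : ℂ)) ≠ 0 :=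
    Finset.prod_ne_zero_iff.2 fun i _ => by exact_mod_cast Nat.factorial_ne_zero _
  rw [hom, schurNorm_eq, ← f1, ← f2]
  rw [← f1] at g1
  rw [← f2] at g2
  have g3 := left_ne_zero_of_mul g1
  have g4 := left_ne_zero_of_mul g2
  generalize dlt z = Z
  field_simp

theorem super_fact (m n : ℕ) : (∏ i ∈ Finset.range m, ∏ j ∈ Finset.range n, ((m : ℂ) + n - i - j - 1)) *
    ((∏ i ∈ Finset.range m, (i.factorial : ℂ)) * ∏ i ∈ Finset.range n, (i.factorial : ℂ)) =
    ∏ i ∈ Finset.range (m + n), (i.factorial : ℂ) := by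
  have e : ∏ i ∈ Finset.range m, ∏ j ∈ Finset.range n, ((m : ℂ) + n - i - j - 1) =
      ∏ i ∈ Finset.range m, ∏ j ∈ Finset.range n, ((i : ℂ) + j + 1) := by
    rw [← Finset.prod_range_reflect]
    refine Finset.prod_congr rfl fun i hi => ?_
    rw [← Finset.prod_range_reflect]
    refine Finset.prod_congr rfl fun j hj => ?_
    have hi := Finset.mem_range.1 hi
    have hj := Finset.mem_range.1 hj
    push_cast [show i ≤ m - 1 by omega, show 1 ≤ m by omega, show j ≤ n - 1 by omega, show 1 ≤ n by omega]
    ring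
  have e2 : ∀ i : ℕ, (∏ j ∈ Finset.range n, ((i : ℂ) + j + 1)) * i.factorial = ((n + i).factorial : ℂ) := by
    intro i
    induction n with
    | zero => simp
    | succ n ih =>
      rw [Finset.prod_range_succ, show n + 1 + i = (n + i) + 1 by ring, Nat.factorial_succ]
      push_cast
      rw [← ih (by
        rw [← Finset.prod_range_reflect]
        refine Finset.prod_congr rfl fun i hi => ?_
        rw [← Finset.prod_range_reflect]
        refine Finset.prod_congr rfl fun j hj => ?_
        have hi := Finset.mem_range.1 hi
        have hj := Finset.mem_range.1 hj
        push_cast [show i ≤ m - 1 by omega, show 1 ≤ m by omega, show j ≤ n - 1 by omega, show 1 ≤ n by omega]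
        ring)]
      ring
  rw [e, ← mul_assoc, ← Finset.prod_mul_distrib, Finset.prod_congr rfl fun i _ => e2 i,
    add_comm m n, Finset.prod_range_add, mul_comm]

/-- Schur function form of the main identity: for a nonnegative
integer `s` and (distinct) complex variables `z₁,…,z_{m+n}`,
`∑_λ a_s(λ) s_λ(z)/s_λ(1^{m+n})
  = ∑_{μ,ν} b_s(μ,ν) s_μ(z₁,…,z_m)s_ν(z_{m+1},…,z_{m+n})/(s_μ(1^m)s_ν(1^n))`,
where `a_s(λ) = 1/(h(λ)h(λ+(s^{m+n})))` and
`b_s(μ,ν) = ∏_{i,j}((m+n-i-j+1)/(μᵢ+νⱼ+m+n-i-j+s+1)) /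
  (h(μ)h(ν)h(μ+(s^m))h(ν+(s^n)))` (the products over `1 ≤ i ≤ m`,
`1 ≤ j ≤ n`, written below 0-indexed). -/
theorem stmt12 (m n s : ℕ) (z : Fin (m + n) → ℂ) (hz : Function.Injective z) :
    ∑' lam : PartLE (m + n),
        (1 / ((hookProd (m + n) lam.1 : ℂ) *
            (hookProd (m + n) (fun i => if i < m + n then lam.1 i + s else 0) : ℂ))) *
          schurNorm z lam.1 =
      ∑' p : PartLE m × PartLE n,
        ((∏ i ∈ Finset.range m, ∏ j ∈ Finset.range n,
            (((m : ℂ) + n - i - j - 1) /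
              ((p.1.1 i : ℂ) + (p.2.1 j : ℂ) + m + n - i - j + s - 1))) /
          ((hookProd m p.1.1 : ℂ) * (hookProd n p.2.1 : ℂ) *
            (hookProd m (fun i => if i < m then p.1.1 i + s else 0) : ℂ) *
            (hookProd n (fun i => if i < n then p.2.1 i + s else 0) : ℂ))) *
          (schurNorm (fun a : Fin m => z (Fin.castAdd n a)) p.1.1 *
            schurNorm (fun b : Fin n => z (Fin.natAdd m b)) p.2.1) := by
  set x : Fin m → ℂ := fun a => z (Fin.castAdd n a) with hx
  set y : Fin n → ℂ := fun b => z (Fin.natAdd m b) with hy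
  obtain ⟨S, hS1, hS2⟩ := core_all s m n x y
  have hzxy : dlt z = dlt x * dlt y * ∏ i, ∏ j, (x i - y j) := by
    rw [← dlt_append]
    congr 1
    funext r
    refine Fin.addCases (fun i => ?_) (fun j => ?_) r <;> simp [hx, hy]
  have hz0 : dlt z ≠ 0 := dlt_ne_zero z hz
  -- left side
  have hL : HasSum (fun K : Fin (m + n) → ℕ => dlt (fun i => (K i : ℂ)) * ∏ i, W s (z i) (K i))
      ((∏ i, ∏ j, (x i - y j)) * S) := by
    rw [← append_hasSum]
    simp only [dlt_split s z x y (fun _ => rfl) (fun _ => rfl)]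
    exact hS2
  have hL2 := part_sum (m + n) _ _ hL (fun K hK => by rw [cast_not_inj K hK, zero_mul])
  simp only [antisym] at hL2
  have hL3 := hL2.mul_left ((∏ i ∈ Finset.range (m + n), (i.factorial : ℂ)) / dlt z)
  simp only [← term_eq] at hL3
  rw [hL3.tsum_eq]
  -- right side
  have hR2 := part_sum2 m n _ _ hS1 (fun p hp => by simp [cast_not_inj p.1 hp])
    (fun p hp => by simp [cast_not_inj p.2 hp])
  have hR3 := hR2.mul_left ((∏ i ∈ Finset.range m, ∏ j ∈ Finset.range n, ((m : ℂ) + n - i - j - 1)) *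
    ((∏ i ∈ Finset.range m, (i.factorial : ℂ)) / dlt x * ((∏ i ∈ Finset.range n, (i.factorial : ℂ)) / dlt y)))
  have hval : ((∏ i ∈ Finset.range (m + n), (i.factorial : ℂ)) / dlt z) * ((∏ i, ∏ j, (x i - y j)) * S) =
    ((∏ i ∈ Finset.range m, ∏ j ∈ Finset.range n, ((m : ℂ) + n - i - j - 1)) *
    ((∏ i ∈ Finset.range m, (i.factorial : ℂ)) / dlt x * ((∏ i ∈ Finset.range n, (i.factorial : ℂ)) / dlt y))) * S := by
    rw [← super_fact, hzxy]
    rw [hzxy] at hz0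
    have a1 := right_ne_zero_of_mul hz0
    have a2 := right_ne_zero_of_mul (left_ne_zero_of_mul hz0)
    have a3 := left_ne_zero_of_mul (left_ne_zero_of_mul hz0)
    generalize (∏ i ∈ Finset.range m, ∏ j ∈ Finset.range n, ((m : ℂ) + n - i - j - 1)) = A
    generalize (∏ i, ∏ j, (x i - y j)) = B at *
    field_simp
  rw [hval, ← hR3.tsum_eq]
  refine tsum_congr fun p => ?_
  set k := shiftK m p.1.1 with hk
  set l := shiftK n p.2.1 with hl
  have hden : ∏ i ∈ Finset.range m, ∏ j ∈ Finset.range n,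
      (((m : ℂ) + n - i - j - 1) / ((p.1.1 i : ℂ) + (p.2.1 j : ℂ) + m + n - i - j + s - 1)) =
      (∏ i ∈ Finset.range m, ∏ j ∈ Finset.range n, ((m : ℂ) + n - i - j - 1)) /
      ∏ i, ∏ j, ((k i : ℂ) + l j + s + 1) := by
    simp only [Finset.prod_div_distrib]
    congr 1
    rw [← Fin.prod_univ_eq_prod_range (fun i => ∏ j ∈ Finset.range n,
      ((p.1.1 i : ℂ) + (p.2.1 j : ℂ) + m + n - i - j + s - 1)) m]
    refine Finset.prod_congr rfl fun i _ => ?_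
    rw [← Fin.prod_univ_eq_prod_range (fun j =>
      ((p.1.1 i : ℂ) + (p.2.1 j : ℂ) + m + n - (i : ℕ) - j + s - 1)) n]
    refine Finset.prod_congr rfl fun j _ => ?_
    have hi := i.2
    have hj := j.2
    simp only [hk, hl, shiftK]
    push_cast [show (i : ℕ) ≤ m - 1 by omega, show 1 ≤ m by omega, show (j : ℕ) ≤ n - 1 by omega,
      show 1 ≤ n by omega]
    ring
  have hsum : ∑ τ : Equiv.Perm (Fin m) × Equiv.Perm (Fin n),
      dlt (fun i => (k (τ.1 i) : ℂ)) * dlt (fun j => (l (τ.2 j) : ℂ)) /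
        (∏ i, ∏ j, ((k (τ.1 i) : ℂ) + l (τ.2 j) + s + 1)) *
        ((∏ i, W s (x i) (k (τ.1 i))) * ∏ j, W s (y j) (l (τ.2 j))) =
      (dlt (fun i => (k i : ℂ)) * om s k * (Matrix.of fun i j => x i ^ k j).det) *
      (dlt (fun i => (l i : ℂ)) * om s l * (Matrix.of fun i j => y i ^ l j).det) /
      ∏ i, ∏ j, ((k i : ℂ) + l j + s + 1) := by
    rw [← antisym, ← antisym, Finset.sum_mul_sum, ← Finset.sum_product', Finset.sum_div]
    refine Finset.sum_congr rfl fun τ _ => ?_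
    have : (∏ i, ∏ j, ((k (τ.1 i) : ℂ) + l (τ.2 j) + s + 1)) =
        ∏ i, ∏ j, ((k i : ℂ) + l j + s + 1) := by
      rw [← Equiv.prod_comp τ.1 (fun i => ∏ j, ((k i : ℂ) + l j + s + 1))]
      refine Finset.prod_congr rfl fun i _ => ?_
      rw [← Equiv.prod_comp τ.2 (fun j => ((k (τ.1 i) : ℂ) + l j + s + 1))]
    rw [this]
    ring
  rw [hsum, hden]
  have t1 := term_eq s m x p.1
  have t2 := term_eq s n y p.2
  rw [← hk] at t1
  rw [← hl] at t2
  generalize (∏ i ∈ Finset.range m, ∏ j ∈ Finset.range n, ((m : ℂ) + n - i - j - 1)) = A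
  generalize (∏ i, ∏ j, ((k i : ℂ) + l j + s + 1)) = R
  have t3 := congrArg₂ (fun a b => A / R * (a * b)) t1 t2
  beta_reduce at t3
  refine Eq.trans ?_ (t3.symm.trans ?_)
  · ring
  · ring
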